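/- For all integers m ≥ 1 and n ≥ 2m, p_{2,1}(m,n) = p_{2,1}(m-1, n-2m) + p_{2,2}(m, n-2m), where p_{2,i}(m,n) counts partitions of n with exactly m parts, at most i-1 parts equal to 1, every even part at least 2m, and odd parts (in decreasing order) satisfying λ_{j_ℓ} - λ_{j_{ℓ+2}} ≥ 4. -/

import Mathlib

/-!
Formalization of statements from "Even-Odd partition identities of
Rogers-Ramanujan type" (P. Afsharijoo).

A partition of `n` is modelled by Mathlib's `Nat.Partition n` (a multiset of
positive parts summing to `n`).  Sorted-in-increasing-order lists of parts are
used to express the conditions on consecutive parts of the decreasing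
enumeration `λ_1 ≥ λ_2 ≥ …`.
-/

/-- The parts of a partition, sorted in increasing order. -/
def Nat.Partition.sortedParts {n : ℕ} (p : n.Partition) : List ℕ :=
  p.parts.sort (· ≤ ·)

/-- The odd parts of a partition, sorted in increasing order. -/
def Nat.Partition.oddParts {n : ℕ} (p : n.Partition) : List ℕ :=
  (p.parts.filter (fun x => ¬ Even x)).sort (· ≤ ·)

/-- The even parts of a partition, sorted in increasing order. -/
def Nat.Partition.evenParts {n : ℕ} (p : n.Partition) : List ℕ :=
  (p.parts.filter (fun x => Even x)).sort (· ≤ ·)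

/-- `GapCond L d g` : any two entries of `L` lying `d` positions apart differ by at
least `g`.  When `L` lists parts in increasing order, this says that the
corresponding decreasing enumeration `λ_1 ≥ λ_2 ≥ …` satisfies
`λ_ℓ - λ_{ℓ+d} ≥ g` for every valid index `ℓ`.
In particular `GapCond p.sortedParts 1 2` says that any two parts of `p`
differ by at least `2` (no equal and no consecutive parts), and
`GapCond p.oddParts 2 4` says that the odd parts satisfy
`λ_{j_ℓ} - λ_{j_{ℓ+2}} ≥ 4`. -/
def GapCond (L : List ℕ) (d g : ℕ) : Prop :=
  ∀ ℓ : ℕ, ℓ + d < L.length → g ≤ L[ℓ + d]! - L[ℓ]!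

/-- `p2 i m n` = number of partitions of `n` with exactly `m` parts, at most
`i - 1` parts equal to `1`, every even part at least `2m`, and odd parts (in
decreasing order) satisfying `λ_{j_ℓ} - λ_{j_{ℓ+2}} ≥ 4`. -/
noncomputable def p2 (i m n : ℕ) : ℕ :=
  Nat.card {p : n.Partition //
    Multiset.card p.parts = m ∧
    Multiset.count 1 p.parts ≤ i - 1 ∧
    (∀ x ∈ p.parts, Even x → 2 * m ≤ x) ∧
    GapCond p.oddParts 2 4}

theorem gapCond_cons_cons_cons (a b c g : ℕ) (L : List ℕ) :
    GapCond (a :: b :: c :: L) 2 g ↔ g ≤ c - a ∧ GapCond (b :: c :: L) 2 g := by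
  constructor
  · intro h
    refine ⟨by simpa using h 0 (by simp), fun l hl => ?_⟩
    simpa [Nat.add_right_comm l 1 2] using h (l + 1) (by simp at hl ⊢; omega)
  · rintro ⟨h₀, h⟩ l hl
    cases l with
    | zero => simpa using h₀
    | succ l => simpa [Nat.add_right_comm l 1 2] using h l (by simp at hl ⊢; omega)

/-- For a weakly increasing list of odd numbers, entries two positions apart differ by at least `4`
exactly when no two consecutive odd values occur more than twice in total. -/
theorem gapCond_two_four_iff_count (L : List ℕ) (hs : L.Pairwise (· ≤ ·))
    (ho : ∀ x ∈ L, Odd x) :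
    GapCond L 2 4 ↔ ∀ j, L.count (2 * j + 1) + L.count (2 * j + 3) ≤ 2 := by
  match L with
  | [] => simp [GapCond]
  | [a] =>
    refine ⟨fun _ j => ?_, fun _ l hl => by simp at hl⟩
    simp only [List.count_cons, List.count_nil]
    grind
  | [a, b] =>
    refine ⟨fun _ j => ?_, fun _ l hl => by simp at hl⟩
    simp only [List.count_cons, List.count_nil]
    grind
  | a :: b :: c :: L =>
    rw [gapCond_cons_cons_cons, gapCond_two_four_iff_count (b :: c :: L) hs.of_cons
      fun x hx => ho x (List.mem_cons_of_mem _ hx)]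
    obtain ⟨ha, hb, hc, -⟩ : (∀ x ∈ b :: c :: L, a ≤ x) ∧ (∀ x ∈ c :: L, b ≤ x) ∧
        (∀ x ∈ L, c ≤ x) ∧ L.Pairwise (· ≤ ·) := by
      simpa only [List.pairwise_cons] using hs
    have hab : a ≤ b := ha b (by simp)
    have hbc : b ≤ c := hb c (by simp)
    obtain ⟨i, rfl⟩ := ho a (by simp)
    obtain ⟨i', rfl⟩ := ho b (by simp)
    obtain ⟨i'', rfl⟩ := ho c (by simp)
    constructor
    · rintro ⟨hg, h⟩ j
      have h₁ := h j
      have hL : ∀ x, x < 2 * i'' + 1 → L.count x = 0 := fun x hx =>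
        List.count_eq_zero.2 fun hm => by have := hc x hm; omega
      have h₂ := hL (2 * j + 1)
      have h₃ := hL (2 * j + 3)
      simp only [List.count_cons, beq_iff_eq] at h₁ ⊢
      split_ifs at h₁ ⊢ <;> omega
    · intro h
      refine ⟨?_, fun j => (Nat.add_le_add ?_ ?_).trans (h j)⟩
      · by_contra hlt
        have h₁ := h i
        simp only [List.count_cons, beq_iff_eq] at h₁
        split_ifs at h₁ <;> omega
      · exact List.count_le_count_cons
      · exact List.count_le_count_cons

/-- The multisets of parts of the partitions counted by `p2 i m n`. -/
def p2Parts (i m n : ℕ) : Set (Multiset ℕ) :=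
  {s | 0 ∉ s ∧ s.sum = n ∧ s.card = m ∧ s.count 1 ≤ i - 1 ∧
    (∀ x ∈ s, Even x → 2 * m ≤ x) ∧
    ∀ j, s.count (2 * j + 1) + s.count (2 * j + 3) ≤ 2}

theorem Nat.Partition.gapCond_oddParts_iff {n : ℕ} (p : n.Partition) :
    GapCond p.oddParts 2 4 ↔
      ∀ j, p.parts.count (2 * j + 1) + p.parts.count (2 * j + 3) ≤ 2 := by
  rw [gapCond_two_four_iff_count p.oddParts (Multiset.pairwise_sort _ _)
    (by simp [Nat.Partition.oddParts])]
  have hc : ∀ x, Odd x → p.oddParts.count x = p.parts.count x := fun x hx => by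
    rw [← Multiset.coe_count, Nat.Partition.oddParts, Multiset.sort_eq,
      Multiset.count_filter_of_pos (by simpa using hx)]
  refine forall_congr' fun j => ?_
  rw [hc _ ⟨j, rfl⟩, hc _ ⟨j + 1, by ring⟩]

theorem p2Parts_eq_image (i m n : ℕ) :
    p2Parts i m n = Nat.Partition.parts '' {p : n.Partition |
      Multiset.card p.parts = m ∧ Multiset.count 1 p.parts ≤ i - 1 ∧
      (∀ x ∈ p.parts, Even x → 2 * m ≤ x) ∧ GapCond p.oddParts 2 4} := by
  ext s
  constructor
  · rintro ⟨h0, hs, h⟩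
    refine ⟨⟨s, fun {x} hx => Nat.pos_of_ne_zero fun h => h0 (h ▸ hx), hs⟩, ?_, rfl⟩
    simpa only [Set.mem_ofPred_eq, Nat.Partition.gapCond_oddParts_iff] using h
  · rintro ⟨p, hp, rfl⟩
    refine ⟨fun h => (p.parts_pos h).ne rfl, p.parts_sum, ?_⟩
    simpa only [Set.mem_ofPred_eq, Nat.Partition.gapCond_oddParts_iff] using hp

theorem finite_p2Parts (i m n : ℕ) : (p2Parts i m n).Finite := by
  rw [p2Parts_eq_image]
  exact (Set.toFinite _).image _

theorem p2_eq_ncard (i m n : ℕ) : p2 i m n = (p2Parts i m n).ncard := by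
  rw [p2Parts_eq_image, Set.ncard_image_of_injective _ fun _ _ => Nat.Partition.ext]
  rfl

theorem Multiset.count_map_add_right (c x : ℕ) (s : Multiset ℕ) :
    (s.map (· + c)).count x = if c ≤ x then s.count (x - c) else 0 := by
  split_ifs with h
  · obtain ⟨y, rfl⟩ := Nat.exists_eq_add_of_le' h
    rw [Nat.add_sub_cancel]
    exact Multiset.count_map_eq_count' _ _ (add_left_injective c) y
  · refine Multiset.count_eq_zero.2 fun hx => ?_
    obtain ⟨y, -, rfl⟩ := Multiset.mem_map.1 hx
    omega

theorem Multiset.exists_map_add_right_eq (c : ℕ) (s : Multiset ℕ) (h : ∀ x ∈ s, c ≤ x) :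
    ∃ t : Multiset ℕ, t.map (· + c) = s := by
  refine ⟨s.map (· - c), ?_⟩
  rw [Multiset.map_map]
  exact (Multiset.map_congr rfl fun x hx => Nat.sub_add_cancel (h x hx)).trans s.map_id

theorem Multiset.sum_map_add_right (c : ℕ) (s : Multiset ℕ) :
    (s.map (· + c)).sum = s.sum + s.card * c := by
  simp [Multiset.sum_map_add]

theorem p2Parts_inter_mem_eq_image (m n : ℕ) (hm : 1 ≤ m) (hn : 2 * m ≤ n) :
    {s ∈ p2Parts 1 m n | 2 * m ∈ s} =
      (2 * m ::ₘ ·) '' {q ∈ p2Parts 1 (m - 1) (n - 2 * m) | 2 * (m - 1) ∉ q} := by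
  have hc (q : Multiset ℕ) (j : ℕ) : (2 * m ::ₘ q).count (2 * j + 1) = q.count (2 * j + 1) :=
    Multiset.count_cons_of_ne (by omega) q
  have hc' (q : Multiset ℕ) (j : ℕ) : (2 * m ::ₘ q).count (2 * j + 3) = q.count (2 * j + 3) :=
    Multiset.count_cons_of_ne (by omega) q
  ext s
  constructor
  · rintro ⟨⟨h0, hs, hk, h1, he, hg⟩, hmem⟩
    obtain ⟨q, rfl⟩ := Multiset.exists_cons_of_mem hmem
    simp only [Multiset.mem_cons, Multiset.sum_cons, Multiset.card_cons] at h0 hs hk he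
    refine ⟨q, ⟨⟨by tauto, by omega, by omega, (hc q 0).symm.trans_le h1,
      fun x hx hx' => ?_, fun j => ?_⟩, fun hx => ?_⟩, rfl⟩
    · have := he x (Or.inr hx) hx'
      omega
    · simpa only [hc q j, hc' q j] using hg j
    · have := he _ (Or.inr hx) (even_two_mul _)
      omega
  · rintro ⟨q, ⟨⟨h0, hs, hk, h1, he, hg⟩, hmem⟩, rfl⟩
    refine ⟨⟨?_, ?_, ?_, (hc q 0).trans_le h1, fun x hx hx' => ?_, fun j => ?_⟩, by simp⟩
    · simp only [Multiset.mem_cons]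
      rintro (h | h)
      · omega
      · exact h0 h
    · simp only [Multiset.sum_cons]
      omega
    · simp only [Multiset.card_cons]
      omega
    · rcases Multiset.mem_cons.1 hx with rfl | hx
      · exact le_rfl
      · have := he x hx hx'
        have : x ≠ 2 * (m - 1) := fun h => hmem (h ▸ hx)
        obtain ⟨y, rfl⟩ := hx'
        omega
    · simpa only [hc q j, hc' q j] using hg j

theorem p2Parts_inter_count_le_eq_image (m n : ℕ) (hn : 2 * m ≤ n) :
    {s ∈ p2Parts 1 m n | 2 * m ∉ s ∧ s.count 3 ≤ 1} =
      Multiset.map (· + 2) '' p2Parts 2 m (n - 2 * m) := by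
  ext s
  constructor
  · rintro ⟨⟨h0, hs, hk, h1, he, hg⟩, hmem, h3⟩
    have h1' : 1 ∉ s := Multiset.count_eq_zero.1 (by omega)
    obtain ⟨t, rfl⟩ := Multiset.exists_map_add_right_eq 2 s fun x hx => by
      have : x ≠ 0 := fun h => h0 (h ▸ hx)
      have : x ≠ 1 := fun h => h1' (h ▸ hx)
      omega
    rw [Multiset.sum_map_add_right] at hs
    rw [Multiset.card_map] at hk
    have he' : ∀ x ∈ t, Even x → 2 * m ≤ x := fun x hx hx' => by
      have := he (x + 2) (Multiset.mem_map_of_mem _ hx) (hx'.add even_two)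
      have : x + 2 ≠ 2 * m := fun h => hmem (h ▸ Multiset.mem_map_of_mem (· + 2) hx)
      obtain ⟨y, rfl⟩ := hx'
      omega
    refine ⟨t, ⟨fun h => ?_, by rw [hk] at hs; omega, hk, ?_, he', fun j => ?_⟩, rfl⟩
    · have := he' 0 h Even.zero
      have := Multiset.card_pos_iff_exists_mem.2 ⟨0, h⟩
      omega
    · simpa [Multiset.count_map_add_right] using h3
    · have h := hg (j + 1)
      simp only [Multiset.count_map_add_right] at h
      rw [if_pos (by omega), if_pos (by omega)] at h
      exact h
  · rintro ⟨t, ⟨h0, hs, hk, h1, he, hg⟩, rfl⟩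
    refine ⟨⟨by simp, ?_, by simpa using hk, ?_, ?_, fun j => ?_⟩, ?_, ?_⟩
    · rw [Multiset.sum_map_add_right, hk]
      omega
    · simp
    · simp only [Multiset.mem_map]
      rintro _ ⟨x, hx, rfl⟩ hx'
      have := he x hx (by simpa [Nat.even_add] using hx')
      omega
    · simp only [Multiset.count_map_add_right]
      cases j with
      | zero => simpa using h1.trans one_le_two
      | succ j =>
        rw [if_pos (by omega), if_pos (by omega)]
        exact hg j
    · simp only [Multiset.mem_map]
      rintro ⟨x, hx, hxm⟩
      have := he x hx ⟨m - 1, by omega⟩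
      omega
    · simpa [Multiset.count_map_add_right] using h1

theorem p2Parts_inter_le_count_eq_image (m n : ℕ) (hn : 2 * m ≤ n) :
    {s ∈ p2Parts 1 m n | 2 * m ∉ s ∧ 2 ≤ s.count 3} =
      (fun v : Multiset ℕ => 3 ::ₘ 3 ::ₘ v.map (· + 4)) ''
        {v | 2 * (m - 1) ::ₘ v ∈ p2Parts 1 (m - 1) (n - 2 * m)} := by
  have hc (q : Multiset ℕ) (j : ℕ) :
      (2 * (m - 1) ::ₘ q).count (2 * j + 1) = q.count (2 * j + 1) :=
    Multiset.count_cons_of_ne (by omega) q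
  have hc' (q : Multiset ℕ) (j : ℕ) : (2 * (m - 1) ::ₘ q).count (2 * j + 3) = q.count (2 * j + 3) :=
    Multiset.count_cons_of_ne (by omega) q
  ext s
  constructor
  · rintro ⟨⟨h0, hs, hk, h1, he, hg⟩, hmem, h3⟩
    obtain ⟨u, rfl⟩ : ∃ u : Multiset ℕ, s = 3 ::ₘ 3 ::ₘ u := by
      obtain ⟨u, rfl⟩ := Multiset.exists_cons_of_mem
        (Multiset.count_pos.1 (by omega : 0 < s.count 3))
      rw [Multiset.count_cons_self] at h3
      obtain ⟨w, rfl⟩ := Multiset.exists_cons_of_mem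
        (Multiset.count_pos.1 (by omega : 0 < u.count 3))
      exact ⟨w, rfl⟩
    simp only [Multiset.mem_cons, Multiset.sum_cons, Multiset.card_cons, Multiset.count_cons]
      at h0 hs hk h1 he hg hmem
    have hu1 : 1 ∉ u := Multiset.count_eq_zero.1 (by simpa using h1)
    have hu3 : 3 ∉ u := Multiset.count_eq_zero.1 (by have := hg 0; norm_num at this; omega)
    have hu5 : 5 ∉ u := Multiset.count_eq_zero.1 (by have := hg 1; norm_num at this; omega)
    have hue : ∀ x ∈ u, Even x → 2 * m + 2 ≤ x := fun x hx hx' => by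
      have := he x (by tauto) hx'
      have : x ≠ 2 * m := fun h => hmem (by rw [← h]; tauto)
      obtain ⟨y, rfl⟩ := hx'
      omega
    obtain ⟨v, rfl⟩ := Multiset.exists_map_add_right_eq 4 u fun x hx => by
      rcases Nat.even_or_odd x with hx' | ⟨y, rfl⟩
      · have := hue x hx hx'
        omega
      · have : y ≠ 0 := fun h => hu1 (by simpa [h] using hx)
        have : y ≠ 1 := fun h => hu3 (by simpa [h] using hx)
        omega
    rw [Multiset.sum_map_add_right] at hs
    rw [Multiset.card_map] at hk
    refine ⟨v, ⟨?_, ?_, ?_, ?_, ?_, fun j => ?_⟩, rfl⟩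
    · rw [Multiset.mem_cons]
      rintro (h | h)
      · omega
      · have := hue 4 (by simpa using h) (by decide)
        omega
    · rw [Multiset.sum_cons]
      omega
    · rw [Multiset.card_cons]
      omega
    · rw [hc v 0]
      exact (Multiset.count_eq_zero.2 fun h => hu5 (by simpa using h)).le
    · intro x hx hx'
      rcases Multiset.mem_cons.1 hx with rfl | hx
      · exact le_rfl
      · have := hue (x + 4) (Multiset.mem_map_of_mem _ hx) (hx'.add (by decide))
        omega
    · rw [hc v j, hc' v j]
      have h := hg (j + 2)
      simp only [Multiset.count_map_add_right] at h
      rw [if_pos (by omega : 4 ≤ 2 * (j + 2) + 1), if_pos (by omega : 4 ≤ 2 * (j + 2) + 3),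
        if_neg (by omega : ¬2 * (j + 2) + 1 = 3), if_neg (by omega : ¬2 * (j + 2) + 3 = 3)] at h
      exact h
  · rintro ⟨v, ⟨h0, hs, hk, h1, he, hg⟩, rfl⟩
    simp only [Multiset.sum_cons, Multiset.card_cons] at hs hk
    have h1 : v.count 1 = 0 := by
      have := hc v 0
      simp only [mul_zero, zero_add] at this
      omega
    have he' : ∀ x ∈ v, Even x → 2 * (m - 1) ≤ x := fun x hx => he x (Multiset.mem_cons_of_mem hx)
    refine ⟨⟨by simp, ?_, ?_, ?_, ?_, fun j => ?_⟩, ?_, ?_⟩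
    · simp only [Multiset.sum_cons, Multiset.sum_map_add_right]
      omega
    · simp only [Multiset.card_cons, Multiset.card_map]
      omega
    · simp
    · simp only [Multiset.mem_cons, Multiset.mem_map]
      rintro _ (rfl | rfl | ⟨x, hx, rfl⟩) hx'
      · exact absurd hx' (by decide)
      · exact absurd hx' (by decide)
      · have := he' x hx (by obtain ⟨y, hy⟩ := hx'; exact ⟨y - 2, by omega⟩)
        omega
    · simp only [Multiset.count_cons, Multiset.count_map_add_right]
      match j with
      | 0 => simp
      | 1 => simp [h1]
      | j + 2 =>
        have h := hg j
        rw [hc v j, hc' v j] at h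
        rw [if_pos (by omega : 4 ≤ 2 * (j + 2) + 1), if_pos (by omega : 4 ≤ 2 * (j + 2) + 3),
          if_neg (by omega : ¬2 * (j + 2) + 1 = 3), if_neg (by omega : ¬2 * (j + 2) + 3 = 3)]
        exact h
    · simp only [Multiset.mem_cons, Multiset.mem_map]
      rintro (h | h | ⟨x, hx, h⟩)
      · omega
      · omega
      · have := he' x hx ⟨m - 2, by omega⟩
        omega
    · simp

theorem Set.ncard_sep_add_ncard_sep_not {α : Type*} {s : Set α} (hs : s.Finite) (P : α → Prop) :
    {x ∈ s | P x}.ncard + {x ∈ s | ¬ P x}.ncard = s.ncard :=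
  Set.ncard_inter_add_ncard_sdiff_eq_ncard s {x | P x} hs

/-- For `m ≥ 1` and `n ≥ 2m`,
`p_{2,1}(m,n) = p_{2,1}(m-1, n-2m) + p_{2,2}(m, n-2m)`. -/
theorem p2_recursion_sum (m n : ℕ) (hm : 1 ≤ m) (hn : 2 * m ≤ n) :
    p2 1 m n = p2 1 (m - 1) (n - 2 * m) + p2 2 m (n - 2 * m) := by
  have hsplit := Set.ncard_sep_add_ncard_sep_not (finite_p2Parts 1 m n) (2 * m ∈ ·)
  have hsplit' := Set.ncard_sep_add_ncard_sep_not
    ((finite_p2Parts 1 m n).subset (Set.sep_subset _ (2 * m ∉ ·))) (Multiset.count 3 · ≤ 1)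
  have hsplit'' := Set.ncard_sep_add_ncard_sep_not
    (finite_p2Parts 1 (m - 1) (n - 2 * m)) (2 * (m - 1) ∈ ·)
  have hD : {q ∈ p2Parts 1 (m - 1) (n - 2 * m) | 2 * (m - 1) ∈ q} =
      (2 * (m - 1) ::ₘ ·) '' {v | 2 * (m - 1) ::ₘ v ∈ p2Parts 1 (m - 1) (n - 2 * m)} := by
    ext q
    constructor
    · rintro ⟨hq, hmem⟩
      obtain ⟨v, rfl⟩ := Multiset.exists_cons_of_mem hmem
      exact ⟨v, hq, rfl⟩
    · rintro ⟨v, hv, rfl⟩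
      exact ⟨hv, Multiset.mem_cons_self _ _⟩
  have hcons (a : ℕ) : Function.Injective fun q : Multiset ℕ => a ::ₘ q :=
    fun _ _ h => (Multiset.cons_inj_right a).1 h
  have hmap (c : ℕ) : Function.Injective (Multiset.map (· + c)) :=
    Multiset.map_injective (add_left_injective c)
  simp only [Set.mem_ofPred_eq, and_assoc, not_le, ← Nat.succ_le_iff, Nat.succ_eq_add_one,
    Nat.reduceAdd] at hsplit'
  simp only [p2_eq_ncard]
  have hA := congrArg Set.ncard (p2Parts_inter_mem_eq_image m n hm hn)
  have hB := congrArg Set.ncard (p2Parts_inter_count_le_eq_image m n hn)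
  have hC := congrArg Set.ncard (p2Parts_inter_le_count_eq_image m n hn)
  rw [Set.ncard_image_of_injective _ (hcons _)] at hA
  rw [Set.ncard_image_of_injective _ (hmap 2)] at hB
  rw [Set.ncard_image_of_injective _
    (show Function.Injective fun v : Multiset ℕ => 3 ::ₘ 3 ::ₘ v.map (· + 4) from
      (hcons 3).comp ((hcons 3).comp (hmap 4)))] at hC
  rw [hD, Set.ncard_image_of_injective _ (hcons _)] at hsplit''
  omega
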